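/- For every fixed ε>0 there exist α∈(0,ε) and β>0 such that, with probability tending to 1 as n → ∞, a random graph G ~ G(n,1/2) has the following property: for every bisection A∪B of G in which at least εn vertices of A are unfriendly and at least εn vertices of B are unfriendly, every bisection A₁∪B₁ that can arise as an outcome of an α-swap of A∪B satisfies Δ_{A₁,B₁} ≥ Δ_{A,B} + β n^{3/2}. -/

import Mathlib

open Finset Filter

open scoped Classical

/-- The number of neighbours of `v` (in the graph `G`) lying in the set `S`. -/
noncomputable def degIn {n : ℕ} (G : SimpleGraph (Fin n)) (S : Finset (Fin n)) (v : Fin n) : ℕ :=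
  (S.filter fun w => G.Adj v w).card

/-- The friendliness of a vertex `v` with respect to the bisection `A ∪ Aᶜ`:
the number of neighbours in its own part minus the number of neighbours across. -/
noncomputable def friendliness {n : ℕ} (G : SimpleGraph (Fin n)) (A : Finset (Fin n))
    (v : Fin n) : ℤ :=
  if v ∈ A then (degIn G A v : ℤ) - (degIn G Aᶜ v : ℤ)
  else (degIn G Aᶜ v : ℤ) - (degIn G A v : ℤ)

/-- `A ∪ Aᶜ` is a bisection: the parts' sizes differ by at most one. -/
def IsBisection {n : ℕ} (A : Finset (Fin n)) : Prop :=
  |(A.card : ℤ) - (Aᶜ.card : ℤ)| ≤ 1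

/-- The probability, under the uniform measure on simple graphs on `Fin n`
(i.e. the Erdős–Rényi measure `G(n,1/2)`), of the set of graphs satisfying `P`. -/
noncomputable def graphProb (n : ℕ) (P : SimpleGraph (Fin n) → Prop) : ℝ :=
  ((univ.filter P).card : ℝ) / (Fintype.card (SimpleGraph (Fin n)) : ℝ)

/-- The total friendliness of the bisection `A ∪ Aᶜ`. -/
noncomputable def totalFriendliness {n : ℕ} (G : SimpleGraph (Fin n))
    (A : Finset (Fin n)) : ℤ :=
  ∑ v, friendliness G A v

/-- `P'` is the set of the `m` most unfriendly vertices of the part `P` (with respect to the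
bisection `A ∪ Aᶜ`), ties being broken according to the fixed ordering of `Fin n`. -/
noncomputable def MostUnfriendlyIn {n : ℕ} (G : SimpleGraph (Fin n)) (A P : Finset (Fin n))
    (m : ℕ) (P' : Finset (Fin n)) : Prop :=
  P' ⊆ P ∧ P'.card = m ∧ ∀ v ∈ P', ∀ w ∈ P \ P',
    friendliness G A v < friendliness G A w ∨
      (friendliness G A v = friendliness G A w ∧ v < w)

/-- `A₁ ∪ A₁ᶜ` is a possible outcome of the `α`-swap of the bisection `A ∪ Aᶜ`: first the
`⌊αn⌋` most unfriendly vertices `A' ⊆ A` and `B' ⊆ Aᶜ` are exchanged, and then some subsets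
`S`, `T` of size `⌊α⁴n⌋` of the two resulting parts are exchanged. -/
noncomputable def IsAlphaSwapOutcome {n : ℕ} (α : ℝ) (G : SimpleGraph (Fin n))
    (A A₁ : Finset (Fin n)) : Prop :=
  ∃ A' B' S T : Finset (Fin n),
    MostUnfriendlyIn G A A ⌊α * n⌋₊ A' ∧
    MostUnfriendlyIn G A Aᶜ ⌊α * n⌋₊ B' ∧
    S ⊆ (A \ A') ∪ B' ∧ T ⊆ ((A \ A') ∪ B')ᶜ ∧
    S.card = ⌊α ^ 4 * n⌋₊ ∧ T.card = ⌊α ^ 4 * n⌋₊ ∧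
    A₁ = (((A \ A') ∪ B') \ S) ∪ T

section UnionBound

variable {n : ℕ} {ι : Type*}

lemma graphProb_nonneg (P : SimpleGraph (Fin n) → Prop) : 0 ≤ graphProb n P := by
  unfold graphProb; positivity

lemma graphProb_mono {P Q : SimpleGraph (Fin n) → Prop} (h : ∀ G, P G → Q G) :
    graphProb n P ≤ graphProb n Q := by
  unfold graphProb
  gcongr with G
  exact h G

lemma graphProb_not (P : SimpleGraph (Fin n) → Prop) :
    graphProb n (fun G => ¬ P G) = 1 - graphProb n P := by
  unfold graphProb
  have h := Finset.card_filter_add_card_filter_not (s := (univ : Finset (SimpleGraph (Fin n)))) P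
  have h0 : (0 : ℝ) < Fintype.card (SimpleGraph (Fin n)) := by
    exact_mod_cast Fintype.card_pos
  rw [eq_sub_iff_add_eq, ← add_div, div_eq_one_iff_eq h0.ne', add_comm]
  rw [Finset.card_univ] at h
  rw [← h]
  push_cast
  congr!

lemma graphProb_le_one (P : SimpleGraph (Fin n) → Prop) : graphProb n P ≤ 1 := by
  linarith [graphProb_not P, graphProb_nonneg fun G => ¬ P G]

lemma graphProb_or_le (P Q : SimpleGraph (Fin n) → Prop) :
    graphProb n (fun G => P G ∨ Q G) ≤ graphProb n P + graphProb n Q := by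
  unfold graphProb
  rw [← add_div]
  gcongr
  rw [← Nat.cast_add, Nat.cast_le]
  refine (Finset.card_le_card fun G hG => ?_).trans (Finset.card_union_le _ _)
  simpa using hG

lemma graphProb_exists_le (I : Finset ι) (P : ι → SimpleGraph (Fin n) → Prop) (p : ℝ)
    (h : ∀ i ∈ I, graphProb n (P i) ≤ p) :
    graphProb n (fun G => ∃ i ∈ I, P i G) ≤ I.card * p := by
  calc graphProb n (fun G => ∃ i ∈ I, P i G)
      ≤ ∑ i ∈ I, graphProb n (P i) := by
        unfold graphProb
        rw [← Finset.sum_div]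
        gcongr
        rw [← Nat.cast_sum, Nat.cast_le]
        refine (Finset.card_le_card fun G hG => ?_).trans
          (Finset.card_biUnion_le (s := I) (t := fun i => univ.filter (P i)))
        simpa using hG
    _ ≤ I.card * p := by
        rw [← nsmul_eq_mul]; exact Finset.sum_le_card_nsmul _ _ _ h

/-- Averaging over a family of edge switches: if for every graph `G` at most a proportion `p` of
the switched graphs `G ∆ H i` satisfies `P`, then `P` has probability at most `p`. -/
lemma graphProb_le_of_symmDiff (I : Finset ι) (hI : I.Nonempty) (H : ι → SimpleGraph (Fin n))
    (P : SimpleGraph (Fin n) → Prop) (p : ℝ)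
    (h : ∀ G, ∀ s ⊆ I, (∀ i ∈ s, P (symmDiff G (H i))) → (s.card : ℝ) ≤ p * I.card) :
    graphProb n P ≤ p := by
  unfold graphProb
  have h0 : (0 : ℝ) < Fintype.card (SimpleGraph (Fin n)) := by
    exact_mod_cast Fintype.card_pos
  have hI0 : (0 : ℝ) < I.card := by exact_mod_cast hI.card_pos
  rw [div_le_iff₀ h0]
  have hswitch : ∀ i, (univ.filter fun G => P (symmDiff G (H i))).card = (univ.filter P).card := by
    intro i
    refine Finset.card_bij' (fun G _ => symmDiff G (H i)) (fun G _ => symmDiff G (H i)) ?_ ?_ ?_ ?_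
    all_goals simp
  have hdouble : (I.card : ℝ) * (univ.filter P).card =
      ∑ G : SimpleGraph (Fin n), ((I.filter fun i => P (symmDiff G (H i))).card : ℝ) := by
    have := Finset.sum_card_bipartiteAbove_eq_sum_card_bipartiteBelow
      (s := I) (t := (univ : Finset (SimpleGraph (Fin n)))) (fun i G => P (symmDiff G (H i)))
    simp only [Finset.bipartiteAbove, Finset.bipartiteBelow, hswitch, Finset.sum_const,
      smul_eq_mul] at this
    exact_mod_cast this
  have hsum : ∑ G : SimpleGraph (Fin n), ((I.filter fun i => P (symmDiff G (H i))).card : ℝ) ≤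
      Fintype.card (SimpleGraph (Fin n)) * (p * I.card) := by
    rw [← nsmul_eq_mul, ← Finset.card_univ]
    exact Finset.sum_le_card_nsmul _ _ _ fun G _ =>
      h G _ (Finset.filter_subset _ _) fun i hi => (Finset.mem_filter.mp hi).2
  rw [← hdouble] at hsum
  nlinarith

end UnionBound

section Rademacher

variable {ι : Type*} [Fintype ι]

/-- The sign encoded by a Boolean. -/
def boolSign (b : Bool) : ℝ := if b then -1 else 1

lemma card_le_sum_boolSign (c : ι → ℝ) {V t : ℝ} (hV : 0 < V) (hc : ∑ i, c i ^ 2 ≤ V)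
    (ht : 0 ≤ t) (s : Finset (ι → Bool)) (hs : ∀ ω ∈ s, t ≤ ∑ i, c i * boolSign (ω i)) :
    (s.card : ℝ) ≤
      Real.exp (-t ^ 2 / (2 * V)) * 2 ^ Fintype.card ι := by
  set θ := t / V with hθ
  have hθ0 : 0 ≤ θ := by positivity
  have hmgf : ∑ ω : ι → Bool, Real.exp (θ * ∑ i, c i * boolSign (ω i)) ≤
      2 ^ Fintype.card ι * Real.exp (θ ^ 2 * V / 2) := by
    calc ∑ ω : ι → Bool, Real.exp (θ * ∑ i, c i * boolSign (ω i))
        = ∏ i, ∑ b : Bool, Real.exp (θ * (c i * boolSign b)) := by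
          rw [Finset.prod_univ_sum, Fintype.piFinset_univ]
          simp only [Finset.mul_sum, Real.exp_sum]
      _ ≤ ∏ i, (2 * Real.exp (θ ^ 2 * c i ^ 2 / 2)) := by
          gcongr with i
          have h := Real.cosh_le_exp_half_sq (θ * c i)
          rw [Real.cosh_eq] at h
          simp only [Fintype.sum_bool, boolSign]
          simp only [if_true, Bool.false_eq_true, if_false, mul_neg, mul_one]
          rw [mul_pow] at h
          linarith
      _ = 2 ^ Fintype.card ι * Real.exp (θ ^ 2 * (∑ i, c i ^ 2) / 2) := by
          rw [Finset.prod_mul_distrib, ← Real.exp_sum, Finset.prod_const, Finset.card_univ,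
            Finset.mul_sum, Finset.sum_div]
      _ ≤ _ := by gcongr
  have hmarkov : (s.card : ℝ) * Real.exp (θ * t) ≤
      ∑ ω : ι → Bool, Real.exp (θ * ∑ i, c i * boolSign (ω i)) := by
    calc (s.card : ℝ) * Real.exp (θ * t) = ∑ _ω ∈ s, Real.exp (θ * t) := by
          rw [Finset.sum_const, nsmul_eq_mul]
      _ ≤ ∑ ω ∈ s, Real.exp (θ * ∑ i, c i * boolSign (ω i)) :=
          Finset.sum_le_sum fun ω hω =>
            Real.exp_le_exp.mpr (mul_le_mul_of_nonneg_left (hs ω hω) hθ0)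
      _ ≤ ∑ ω : ι → Bool, Real.exp (θ * ∑ i, c i * boolSign (ω i)) :=
          Finset.sum_le_univ_sum_of_nonneg fun _ => (Real.exp_pos _).le
  have hexp : Real.exp (-t ^ 2 / (2 * V)) * Real.exp (θ * t) = Real.exp (θ ^ 2 * V / 2) := by
    rw [← Real.exp_add]
    congr 1
    rw [hθ]
    field_simp
    ring
  have hpos := Real.exp_pos (θ * t)
  refine le_of_mul_le_mul_right ?_ hpos
  calc _ ≤ _ := hmarkov.trans hmgf
    _ = _ := by rw [← hexp]; ring

lemma card_abs_le_sum_boolSign (c : ι → ℝ) {V t : ℝ} (hV : 0 < V) (hc : ∑ i, c i ^ 2 ≤ V)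
    (ht : 0 ≤ t) (s : Finset (ι → Bool)) (hs : ∀ ω ∈ s, t ≤ |∑ i, c i * boolSign (ω i)|) :
    (s.card : ℝ) ≤ 2 * Real.exp (-t ^ 2 / (2 * V)) * 2 ^ Fintype.card ι := by
  set p : (ι → Bool) → Prop := fun ω => t ≤ ∑ i, c i * boolSign (ω i)
  have h1 := card_le_sum_boolSign c hV hc ht (s.filter p) fun ω hω => (Finset.mem_filter.mp hω).2
  have h2 := card_le_sum_boolSign (fun i => - c i) hV (by simpa using hc) ht
    (s.filter fun ω => ¬ p ω) fun ω hω => by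
      obtain ⟨hωs, hω⟩ := Finset.mem_filter.mp hω
      have := (le_abs.mp (hs ω hωs)).resolve_left hω
      simpa using this
  have h3 : ((s.filter p).card : ℝ) + (s.filter fun ω => ¬ p ω).card = s.card := by
    exact_mod_cast Finset.card_filter_add_card_filter_not (s := s) p
  linarith

end Rademacher

section QuadraticForms

variable {n : ℕ}

/-- The entries of the adjacency matrix of `G`. -/
noncomputable def adjEntry (G : SimpleGraph (Fin n)) (u v : Fin n) : ℝ :=
  if G.Adj u v then 1 else 0

/-- The entries of the `±1` (Seidel-type) matrix of `G`: `1` on edges, `-1` on non-edges and `0`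
on the diagonal. -/
noncomputable def signEntry (G : SimpleGraph (Fin n)) (u v : Fin n) : ℝ :=
  if u = v then 0 else if G.Adj u v then 1 else -1

/-- The bilinear form of the adjacency matrix. -/
noncomputable def adjForm (G : SimpleGraph (Fin n)) (z y : Fin n → ℝ) : ℝ :=
  ∑ u, ∑ v, z u * y v * adjEntry G u v

/-- The bilinear form of the `±1` matrix. -/
noncomputable def signForm (G : SimpleGraph (Fin n)) (z y : Fin n → ℝ) : ℝ :=
  ∑ u, ∑ v, z u * y v * signEntry G u v

/-- The graph whose edges are the pairs selected by `ω`. -/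
def graphOfPairs (ω : Fin n × Fin n → Bool) : SimpleGraph (Fin n) where
  Adj u v := (u < v ∧ ω (u, v)) ∨ (v < u ∧ ω (v, u))
  symm := ⟨fun _ _ h => h.symm⟩
  loopless := ⟨fun u h => by simp at h⟩

lemma signEntry_comm (G : SimpleGraph (Fin n)) (u v : Fin n) :
    signEntry G u v = signEntry G v u := by
  simp only [signEntry, G.adj_comm, eq_comm]

lemma signEntry_symmDiff (G : SimpleGraph (Fin n)) (ω : Fin n × Fin n → Bool) {u v : Fin n}
    (h : u < v) :
    signEntry (symmDiff G (graphOfPairs ω)) u v = signEntry G u v * boolSign (ω (u, v)) := by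
  have h1 : (symmDiff G (graphOfPairs ω)).Adj u v ↔ Xor (G.Adj u v) (ω (u, v)) := by
    simp [symmDiff, graphOfPairs, h, h.not_gt, Xor, and_comm]
  simp only [signEntry, h1, h.ne, if_false, boolSign, Xor]
  by_cases hG : G.Adj u v <;> by_cases hω : ω (u, v) = true <;> simp [hG, hω]

lemma signForm_symmDiff (G : SimpleGraph (Fin n)) (ω : Fin n × Fin n → Bool) (z y : Fin n → ℝ) :
    signForm (symmDiff G (graphOfPairs ω)) z y =
      ∑ p : Fin n × Fin n, (if p.1 < p.2 then
        (z p.1 * y p.2 + z p.2 * y p.1) * signEntry G p.1 p.2 else 0) * boolSign (ω p) := by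
  set G' := symmDiff G (graphOfPairs ω) with hG'
  have hsplit : ∀ u v, z u * y v * signEntry G' u v =
      (if u < v then z u * y v * signEntry G' u v else 0) +
      (if v < u then z u * y v * signEntry G' u v else 0) := by
    intro u v
    rcases lt_trichotomy u v with h | h | h
    · simp [h, h.not_gt]
    · simp [h, signEntry]
    · simp [h, h.not_gt]
  rw [signForm, Finset.sum_congr rfl fun u _ => Finset.sum_congr rfl fun v _ => hsplit u v]
  simp_rw [Finset.sum_add_distrib]
  rw [Finset.sum_comm (f := fun u v => if v < u then z u * y v * signEntry G' u v else 0),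
    ← Finset.sum_add_distrib, Fintype.sum_prod_type]
  refine Finset.sum_congr rfl fun u _ => ?_
  rw [← Finset.sum_add_distrib]
  refine Finset.sum_congr rfl fun v _ => ?_
  by_cases h : u < v
  · simp only [h, if_true]
    rw [signEntry_comm G' v u, hG', signEntry_symmDiff G ω h]
    ring
  · simp [h]

lemma graphProb_le_abs_signForm (z y : Fin n → ℝ) {a b t : ℝ} (ha : 0 < a) (hb : 0 < b)
    (hz : ∑ i, z i ^ 2 ≤ a) (hy : ∑ i, y i ^ 2 ≤ b) (ht : 0 ≤ t) :
    graphProb n (fun G => t ≤ |signForm G z y|) ≤ 2 * Real.exp (-t ^ 2 / (4 * (a * b))) := by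
  refine graphProb_le_of_symmDiff univ univ_nonempty graphOfPairs _ _ fun G s _ hs => ?_
  simp only [signForm_symmDiff] at hs
  refine (card_abs_le_sum_boolSign _ (V := 2 * (a * b)) (by positivity) ?_ ht s hs).trans_eq ?_
  · have hsq : ∀ u v, signEntry G u v ^ 2 ≤ 1 := by
      intro u v
      unfold signEntry
      split_ifs <;> norm_num
    calc ∑ p : Fin n × Fin n, (if p.1 < p.2 then
          (z p.1 * y p.2 + z p.2 * y p.1) * signEntry G p.1 p.2 else 0) ^ 2
        ≤ ∑ p : Fin n × Fin n, ((if p.1 < p.2 then 2 * (z p.1 ^ 2 * y p.2 ^ 2) else 0) +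
            (if p.1 < p.2 then 2 * (z p.2 ^ 2 * y p.1 ^ 2) else 0)) := by
          gcongr with p
          split_ifs with h
          · rw [mul_pow]
            have := hsq p.1 p.2
            nlinarith [sq_nonneg (z p.1 * y p.2 - z p.2 * y p.1),
              mul_le_mul_of_nonneg_left this (sq_nonneg (z p.1 * y p.2 + z p.2 * y p.1))]
          · norm_num
      _ = ∑ u, ∑ v, ((if u < v then 2 * (z u ^ 2 * y v ^ 2) else 0) +
            (if v < u then 2 * (z u ^ 2 * y v ^ 2) else 0)) := by
          rw [Fintype.sum_prod_type]
          simp_rw [Finset.sum_add_distrib]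
          congr 1
          rw [Finset.sum_comm]
      _ ≤ ∑ u, ∑ v, 2 * (z u ^ 2 * y v ^ 2) := by
          gcongr with u _ v _
          have : 0 ≤ 2 * (z u ^ 2 * y v ^ 2) := by positivity
          rcases lt_trichotomy u v with h | h | h
          · simp [h, h.not_gt]
          · subst h; simpa using this
          · simp [h, h.not_gt]
      _ = 2 * ((∑ u, z u ^ 2) * ∑ v, y v ^ 2) := by
          rw [Finset.sum_mul_sum]
          simp_rw [Finset.mul_sum]
      _ ≤ 2 * (a * b) := by gcongr
  · rw [Finset.card_univ, Fintype.card_fun, Fintype.card_bool]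
    push_cast
    congr 3
    ring

end QuadraticForms

section SignVectors

variable {n : ℕ}

/-- The vectors of length `n` with all coordinates in `{-1, 0, 1}`. -/
noncomputable def signVectors (n : ℕ) : Finset (Fin n → ℝ) :=
  Fintype.piFinset fun _ => {-1, 0, 1}

lemma card_signVectors_le (s : Finset (Fin n → ℝ)) (hs : s ⊆ signVectors n) (L M : ℝ)
    (hL : 0 ≤ L) (hM : ∀ z ∈ s, ∑ i, z i ^ 2 ≤ M) :
    (s.card : ℝ) ≤ Real.exp (L * M + 2 * Real.exp (-L) * n) := by
  have hweight : (s.card : ℝ) * Real.exp (-(L * M)) ≤ Real.exp (2 * Real.exp (-L) * n) := by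
    calc (s.card : ℝ) * Real.exp (-(L * M)) = ∑ _z ∈ s, Real.exp (-(L * M)) := by
          rw [Finset.sum_const, nsmul_eq_mul]
      _ ≤ ∑ z ∈ s, Real.exp (∑ i, -L * z i ^ 2) := by
          refine Finset.sum_le_sum fun z hz => Real.exp_le_exp.mpr ?_
          rw [← Finset.mul_sum]
          nlinarith [mul_le_mul_of_nonneg_left (hM z hz) hL]
      _ ≤ ∑ z ∈ signVectors n, Real.exp (∑ i, -L * z i ^ 2) :=
          Finset.sum_le_sum_of_subset_of_nonneg hs fun _ _ _ => (Real.exp_pos _).le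
      _ = ∏ _i : Fin n, ∑ r ∈ ({-1, 0, 1} : Finset ℝ), Real.exp (-L * r ^ 2) := by
          rw [Finset.prod_univ_sum]
          simp only [Real.exp_sum, signVectors]
      _ = (1 + 2 * Real.exp (-L)) ^ n := by
          rw [Finset.prod_const, Finset.card_univ, Fintype.card_fin, Finset.sum_insert (by norm_num),
            Finset.sum_insert (by norm_num), Finset.sum_singleton]
          norm_num
          ring
      _ ≤ Real.exp (2 * Real.exp (-L)) ^ n := by
          gcongr
          linarith [Real.add_one_le_exp (2 * Real.exp (-L))]
      _ = Real.exp (2 * Real.exp (-L) * n) := by rw [← Real.exp_nat_mul, mul_comm]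
  rw [Real.exp_add, ← div_le_iff₀' (Real.exp_pos _), div_eq_mul_inv, ← Real.exp_neg]
  exact hweight

lemma graphProb_exists_signForm_self_le {a t L : ℝ} (ha : 0 < a) (ht : 0 ≤ t) (hL : 0 ≤ L) :
    graphProb n (fun G => ∃ z ∈ (signVectors n).filter (fun z => ∑ i, z i ^ 2 ≤ a),
      t ≤ |signForm G z z|) ≤
      Real.exp (L * a + 2 * Real.exp (-L) * n) * (2 * Real.exp (-t ^ 2 / (4 * (a * a)))) := by
  refine (graphProb_exists_le _ _ _ fun z hz => ?_).trans (mul_le_mul_of_nonneg_right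
    (card_signVectors_le _ (Finset.filter_subset _ _) L a hL fun z hz =>
      (Finset.mem_filter.mp hz).2) (by positivity))
  have hz := (Finset.mem_filter.mp hz).2
  exact graphProb_le_abs_signForm z z ha ha hz hz ht

lemma sum_sq_le_of_mem_signVectors {z : Fin n → ℝ} (hz : z ∈ signVectors n) :
    ∑ i, z i ^ 2 ≤ n := by
  have h : ∀ i ∈ (univ : Finset (Fin n)), z i ^ 2 ≤ 1 := by
    intro i _
    have := Fintype.mem_piFinset.mp hz i
    simp only [Finset.mem_insert, Finset.mem_singleton] at this
    rcases this with h | h | h <;> norm_num [h]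
  simpa using Finset.sum_le_card_nsmul _ _ _ h

lemma graphProb_exists_signForm_le (hn : 0 < n) {a t : ℝ} (ha : 0 < a) (ht : 0 ≤ t) :
    graphProb n (fun G => ∃ p ∈ (signVectors n).filter (fun z => ∑ i, z i ^ 2 ≤ a) ×ˢ
      signVectors n, t ≤ |signForm G p.1 p.2|) ≤
      Real.exp (4 * n) * (2 * Real.exp (-t ^ 2 / (4 * (a * n)))) := by
  have hcard : ∀ s ⊆ signVectors n, (s.card : ℝ) ≤ Real.exp (2 * n) := by
    intro s hs
    simpa using card_signVectors_le s hs 0 n le_rfl fun z hz => sum_sq_le_of_mem_signVectors (hs hz)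
  refine (graphProb_exists_le _ _ _ fun p hp => ?_).trans (mul_le_mul_of_nonneg_right
    ?_ (by positivity))
  · obtain ⟨h1, h2⟩ := Finset.mem_product.mp hp
    exact graphProb_le_abs_signForm p.1 p.2 ha (by positivity) (Finset.mem_filter.mp h1).2
      (sum_sq_le_of_mem_signVectors h2) ht
  · rw [Finset.card_product, Nat.cast_mul, show (4 * n : ℝ) = 2 * n + 2 * n by ring, Real.exp_add]
    gcongr
    · exact hcard _ (Finset.filter_subset _ _)
    · exact hcard _ subset_rfl

end SignVectors

section Anticoncentration

lemma centralBinom_sq_mul_le (k : ℕ) : k.centralBinom ^ 2 * (2 * k + 1) ≤ 16 ^ k := by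
  induction k with
  | zero => simp
  | succ k ih =>
    have h := Nat.succ_mul_centralBinom_succ k
    have hpos : 0 < (k + 1) ^ 2 := by positivity
    refine Nat.le_of_mul_le_mul_left ?_ hpos
    calc (k + 1) ^ 2 * ((k + 1).centralBinom ^ 2 * (2 * (k + 1) + 1))
        = ((k + 1) * (k + 1).centralBinom) ^ 2 * (2 * k + 3) := by ring
      _ = 4 * ((2 * k + 1) * (2 * k + 3)) * (k.centralBinom ^ 2 * (2 * k + 1)) := by
          rw [h]; ring
      _ ≤ 4 * (4 * (k + 1) ^ 2) * 16 ^ k := by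
          have : (2 * k + 1) * (2 * k + 3) ≤ 4 * (k + 1) ^ 2 := by nlinarith
          gcongr
      _ = (k + 1) ^ 2 * 16 ^ (k + 1) := by ring

lemma choose_sq_mul_le (N j : ℕ) : N.choose j ^ 2 * (N + 1) ≤ 4 ^ N := by
  refine (Nat.mul_le_mul_right _ (Nat.pow_le_pow_left (Nat.choose_le_middle j N) 2)).trans ?_
  obtain ⟨k, rfl | rfl⟩ := N.even_or_odd'
  · have := centralBinom_sq_mul_le k
    rw [Nat.centralBinom_eq_two_mul_choose] at this
    rw [pow_mul, Nat.mul_div_cancel_left _ (by norm_num)]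
    exact this
  · have h := centralBinom_sq_mul_le (k + 1)
    have hc : (k + 1).centralBinom = 2 * (2 * k + 1).choose k := by
      rw [Nat.centralBinom_eq_two_mul_choose, show 2 * (k + 1) = 2 * k + 1 + 1 by ring,
        Nat.choose_succ_succ, ← Nat.choose_symm_half k]
      ring
    rw [hc] at h
    rw [show (2 * k + 1) / 2 = k by omega]
    have h4 : 4 ^ (2 * k + 1) * 4 = 16 ^ (k + 1) := by
      rw [← pow_succ, show 2 * k + 1 + 1 = 2 * (k + 1) by ring, pow_mul]
      norm_num
    nlinarith

lemma choose_le_two_pow_div_sqrt (N j : ℕ) : (N.choose j : ℝ) ≤ 2 ^ N / √(N + 1) := by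
  have h : ((N.choose j : ℝ)) ^ 2 * (N + 1) ≤ 4 ^ N := by exact_mod_cast choose_sq_mul_le N j
  rw [le_div_iff₀ (by positivity)]
  refine le_of_sq_le_sq ?_ (by positivity)
  rw [mul_pow, Real.sq_sqrt (by positivity), ← pow_mul, mul_comm N 2, pow_mul]
  norm_num
  exact h

lemma card_nat_le_of_abs_le {c K : ℝ} (hK : 0 ≤ K) (J : Finset ℕ) (hJ : ∀ j ∈ J, |c + j| ≤ K) :
    (J.card : ℝ) ≤ 2 * K + 1 := by
  rcases J.eq_empty_or_nonempty with rfl | hne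
  · simp; linarith
  have hsub : J ⊆ Finset.Icc (J.min' hne) (J.max' hne) := fun j hj =>
    Finset.mem_Icc.mpr ⟨J.min'_le j hj, J.le_max' j hj⟩
  have hcard := Finset.card_le_card hsub
  rw [Nat.card_Icc] at hcard
  have hle := J.min'_le _ (J.max'_mem hne)
  have h1 := abs_le.mp (hJ _ (J.min'_mem hne))
  have h2 := abs_le.mp (hJ _ (J.max'_mem hne))
  have hcard' : J.card + J.min' hne ≤ J.max' hne + 1 := by omega
  have : (J.card : ℝ) + (J.min' hne : ℕ) ≤ (J.max' hne : ℕ) + 1 := by exact_mod_cast hcard'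
  linarith [h1.1, h2.2]

variable {n : ℕ}

/-- The sign vector of a bipartition: `1` on `A` and `-1` off `A`. -/
noncomputable def sideSign (A : Finset (Fin n)) (v : Fin n) : ℝ := if v ∈ A then 1 else -1

lemma sideSign_sq (A : Finset (Fin n)) (v : Fin n) : sideSign A v * sideSign A v = 1 := by
  unfold sideSign; split_ifs <;> norm_num

lemma abs_sideSign (A : Finset (Fin n)) (v : Fin n) : |sideSign A v| = 1 := by
  unfold sideSign; split_ifs <;> norm_num

lemma friendliness_eq (G : SimpleGraph (Fin n)) (A : Finset (Fin n)) (v : Fin n) :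
    (friendliness G A v : ℝ) = sideSign A v * ∑ w, sideSign A w * adjEntry G v w := by
  have hdeg : ∀ S : Finset (Fin n), (degIn G S v : ℝ) = ∑ w ∈ S, adjEntry G v w := by
    intro S
    simp [degIn, adjEntry]
  have hsum : ∑ w, sideSign A w * adjEntry G v w = degIn G A v - degIn G Aᶜ v := by
    rw [← Finset.sum_add_sum_compl A, hdeg, hdeg, sub_eq_add_neg, ← Finset.sum_neg_distrib]
    congr 1
    · exact Finset.sum_congr rfl fun w hw => by simp [sideSign, hw]
    · exact Finset.sum_congr rfl fun w hw => by simp [sideSign, Finset.mem_compl.mp hw]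
  rw [hsum, friendliness, sideSign]
  split_ifs <;> push_cast <;> ring

/-- Erdős–Littlewood–Offord type bound: at most a proportion `(2K + 1) / √(|W| + 1)` of the
subsets `U` of `W` gives a signed sum in a fixed interval of radius `K`. -/
lemma card_subsets_le (A W : Finset (Fin n)) (b : Fin n → Prop) {c K : ℝ} (hK : 0 ≤ K)
    (s : Finset (Finset (Fin n))) (hsW : s ⊆ W.powerset)
    (hs : ∀ U ∈ s, |c + ∑ w ∈ W, sideSign A w * (if Xor (b w) (w ∈ U) then 1 else 0)| ≤ K) :
    (s.card : ℝ) ≤ (2 * K + 1) / √(W.card + 1) * 2 ^ W.card := by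
  set Q := W.filter fun w => Xor (w ∉ A) (b w)
  set q : ℝ := ((W.filter fun w => w ∉ A).card : ℝ)
  set J := (Finset.range (W.card + 1)).filter fun j : ℕ => |(c - q) + j| ≤ K
  have hmap : ∀ U ∈ s, symmDiff U Q ∈ J.biUnion fun j => powersetCard j W := by
    intro U hU
    have hUW := Finset.mem_powerset.mp (hsW hU)
    have hsub : symmDiff U Q ⊆ W := by
      intro w hw
      rcases Finset.mem_symmDiff.mp hw with h | h
      · exact hUW h.1
      · exact (Finset.mem_filter.mp h.1).1
    have hsum : ∑ w ∈ W, sideSign A w * (if Xor (b w) (w ∈ U) then (1 : ℝ) else 0) =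
        (symmDiff U Q).card - q := by
      have h1 : ((symmDiff U Q).card : ℝ) = ∑ w ∈ W, if w ∈ symmDiff U Q then (1 : ℝ) else 0 := by
        rw [Finset.sum_ite_mem, Finset.inter_eq_right.mpr hsub]
        simp
      have h2 : q = ∑ w ∈ W, if w ∉ A then (1 : ℝ) else 0 := by
        rw [Finset.sum_boole]
      rw [h1, h2, ← Finset.sum_sub_distrib]
      refine Finset.sum_congr rfl fun w hw => ?_
      have hQ : w ∈ Q ↔ Xor (w ∉ A) (b w) := by simp [Q, hw]
      simp only [Finset.mem_symmDiff, hQ, sideSign, Xor]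
      by_cases h3 : w ∈ A <;> by_cases h4 : b w <;> by_cases h5 : w ∈ U <;> simp [h3, h4, h5]
    have hU' := hs U hU
    rw [hsum] at hU'
    simp only [Finset.mem_biUnion, Finset.mem_powersetCard, J, Finset.mem_filter, Finset.mem_range]
    refine ⟨_, ⟨Nat.lt_succ_of_le (Finset.card_le_card hsub), ?_⟩, hsub, rfl⟩
    convert hU' using 2
    ring
  have hinj : Set.InjOn (fun U => symmDiff U Q) s := fun U _ U' _ h => by
    simpa using h
  have hcard := (Finset.card_le_card_of_injOn _ hmap hinj).trans Finset.card_biUnion_le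
  simp only [Finset.card_powersetCard] at hcard
  calc (s.card : ℝ) ≤ ∑ j ∈ J, (W.card.choose j : ℝ) := by exact_mod_cast hcard
    _ ≤ J.card * (2 ^ W.card / √(W.card + 1)) := by
        rw [← nsmul_eq_mul]
        exact Finset.sum_le_card_nsmul _ _ _ fun j _ => choose_le_two_pow_div_sqrt _ _
    _ ≤ (2 * K + 1) * (2 ^ W.card / √(W.card + 1)) := by
        gcongr
        exact card_nat_le_of_abs_le hK J fun j hj => (Finset.mem_filter.mp hj).2
    _ = _ := by ring

/-- The bipartite graph between `S` and its complement in which `v ∈ S` is joined to `T v`. -/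
def crossGraph (S : Finset (Fin n)) (T : S → Finset (Fin n)) : SimpleGraph (Fin n) where
  Adj u w := (∃ h : u ∈ S, w ∉ S ∧ w ∈ T ⟨u, h⟩) ∨ (∃ h : w ∈ S, u ∉ S ∧ u ∈ T ⟨w, h⟩)
  symm := ⟨fun _ _ h => h.symm⟩
  loopless := ⟨fun u h => by rcases h with ⟨h1, h2, _⟩ | ⟨h1, h2, _⟩ <;> exact h2 h1⟩

lemma friendliness_symmDiff_crossGraph (G : SimpleGraph (Fin n)) (A S : Finset (Fin n))
    (T : S → Finset (Fin n)) (v : S) :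
    (friendliness (symmDiff G (crossGraph S T)) A v : ℝ) =
      sideSign A v * (∑ w ∈ S, sideSign A w * adjEntry G v w +
        ∑ w ∈ Sᶜ, sideSign A w * (if Xor (G.Adj v w) (w ∈ T v) then 1 else 0)) := by
  rw [friendliness_eq, ← Finset.sum_add_sum_compl S]
  congr 2
  · refine Finset.sum_congr rfl fun w hw => ?_
    simp [adjEntry, symmDiff, crossGraph, hw]
  · refine Finset.sum_congr rfl fun w hw => ?_
    have hw := Finset.mem_compl.mp hw
    have hadj : (symmDiff G (crossGraph S T)).Adj v w ↔ Xor (G.Adj v w) (w ∈ T v) := by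
      simp [symmDiff, crossGraph, hw, Xor]
    simp [adjEntry, hadj]

lemma graphProb_forall_abs_friendliness_le (A S : Finset (Fin n)) {K : ℝ} (hK : 0 ≤ K) :
    graphProb n (fun G => ∀ v ∈ S, |(friendliness G A v : ℝ)| ≤ K) ≤
      ((2 * K + 1) / √(Sᶜ.card + 1)) ^ S.card := by
  refine graphProb_le_of_symmDiff (Fintype.piFinset fun _ : S => Sᶜ.powerset)
    ⟨fun _ => ∅, by simp⟩ (crossGraph S) _ _ fun G s hsI hs => ?_
  set bad : S → Finset (Finset (Fin n)) := fun v => Sᶜ.powerset.filter fun U =>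
    |∑ w ∈ S, sideSign A w * adjEntry G v w +
      ∑ w ∈ Sᶜ, sideSign A w * (if Xor (G.Adj v w) (w ∈ U) then 1 else 0)| ≤ K
  have hsub : s ⊆ Fintype.piFinset bad := by
    intro T hT
    refine Fintype.mem_piFinset.mpr fun v => Finset.mem_filter.mpr
      ⟨Fintype.mem_piFinset.mp (hsI hT) v, ?_⟩
    have := hs T hT v v.2
    rwa [friendliness_symmDiff_crossGraph, abs_mul, abs_sideSign, one_mul] at this
  calc (s.card : ℝ) ≤ ∏ v : S, ((bad v).card : ℝ) := by
        rw [← Nat.cast_prod, ← Fintype.card_piFinset]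
        exact_mod_cast Finset.card_le_card hsub
    _ ≤ ∏ _v : S, ((2 * K + 1) / √(Sᶜ.card + 1) * 2 ^ Sᶜ.card) := by
        gcongr with v
        exact card_subsets_le A Sᶜ (G.Adj v) hK _ (Finset.filter_subset _ _)
          fun U hU => (Finset.mem_filter.mp hU).2
    _ = _ := by
        simp [mul_pow, Fintype.card_piFinset]

lemma graphProb_exists_abs_friendliness_le (s : ℕ) {K : ℝ} (hK : 0 ≤ K) :
    graphProb n (fun G => ∃ p ∈ (univ : Finset (Finset (Fin n))) ×ˢ
      powersetCard s (univ : Finset (Fin n)), ∀ v ∈ p.2, |(friendliness G p.1 v : ℝ)| ≤ K) ≤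
      4 ^ n * ((2 * K + 1) / √((n - s : ℕ) + 1)) ^ s := by
  refine (graphProb_exists_le _ _ (((2 * K + 1) / √((n - s : ℕ) + 1)) ^ s) fun p hp => ?_).trans
    (mul_le_mul_of_nonneg_right ?_ (by positivity))
  · have hcard := (Finset.mem_powersetCard.mp (Finset.mem_product.mp hp).2).2
    have := graphProb_forall_abs_friendliness_le p.1 p.2 hK
    rwa [Finset.card_compl, Fintype.card_fin, hcard] at this
  · rw [Finset.card_product, Finset.card_univ, Fintype.card_finset, Fintype.card_fin]
    have h1 : (powersetCard s (univ : Finset (Fin n))).card ≤ 2 ^ n := by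
      rw [Finset.card_powersetCard, Finset.card_univ, Fintype.card_fin]
      exact Nat.choose_le_two_pow n s
    have h2 : (4 : ℝ) ^ n = ((2 ^ n * 2 ^ n : ℕ) : ℝ) := by
      push_cast; rw [← mul_pow]; norm_num
    rw [h2]
    exact_mod_cast Nat.mul_le_mul_left _ h1

end Anticoncentration

section Swap

variable {n : ℕ}

lemma adjForm_comm (G : SimpleGraph (Fin n)) (z y : Fin n → ℝ) :
    adjForm G z y = adjForm G y z := by
  rw [adjForm, Finset.sum_comm, adjForm]
  refine Finset.sum_congr rfl fun u _ => Finset.sum_congr rfl fun v _ => ?_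
  simp only [adjEntry, G.adj_comm]
  ring

lemma adjForm_sub_two_mul (G : SimpleGraph (Fin n)) (x z : Fin n → ℝ) :
    adjForm G (fun v => x v - 2 * z v) (fun v => x v - 2 * z v) =
      adjForm G x x - 4 * adjForm G z x + 4 * adjForm G z z := by
  have h : adjForm G (fun v => x v - 2 * z v) (fun v => x v - 2 * z v) =
      adjForm G x x - 2 * adjForm G z x - 2 * adjForm G x z + 4 * adjForm G z z := by
    simp only [adjForm, Finset.mul_sum, ← Finset.sum_sub_distrib, ← Finset.sum_add_distrib]
    refine Finset.sum_congr rfl fun u _ => Finset.sum_congr rfl fun v _ => ?_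
    ring
  rw [h, adjForm_comm G x z]
  ring

lemma adjForm_eq_signForm (G : SimpleGraph (Fin n)) (z y : Fin n → ℝ) :
    adjForm G z y = ((∑ u, z u) * (∑ v, y v) - ∑ u, z u * y u + signForm G z y) / 2 := by
  have hentry : ∀ u v, z u * y v * adjEntry G u v =
      (z u * y v - (if u = v then z u * y v else 0) + z u * y v * signEntry G u v) / 2 := by
    intro u v
    unfold adjEntry signEntry
    by_cases huv : u = v
    · subst huv; simp
    · by_cases hG : G.Adj u v
      · simp [huv, hG]
      · simp [huv, hG]
  simp only [adjForm, signForm, hentry, ← Finset.sum_div, Finset.sum_add_distrib,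
    Finset.sum_sub_distrib, Finset.sum_mul_sum, Finset.sum_ite_eq, Finset.mem_univ, if_true]

lemma totalFriendliness_eq_adjForm (G : SimpleGraph (Fin n)) (A : Finset (Fin n)) :
    (totalFriendliness G A : ℝ) = adjForm G (sideSign A) (sideSign A) := by
  simp only [totalFriendliness, Int.cast_sum, friendliness_eq, adjForm, Finset.mul_sum, mul_assoc]

/-- The restriction of the sign vector of `A` to the set `D`. -/
noncomputable def restrictedSign (A D : Finset (Fin n)) (v : Fin n) : ℝ :=
  if v ∈ D then sideSign A v else 0

lemma adjForm_restrictedSign (G : SimpleGraph (Fin n)) (A D : Finset (Fin n)) :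
    adjForm G (restrictedSign A D) (sideSign A) = ∑ v ∈ D, (friendliness G A v : ℝ) := by
  have h : ∑ v ∈ D, (friendliness G A v : ℝ) =
      ∑ v, if v ∈ D then (friendliness G A v : ℝ) else 0 := by
    rw [Finset.sum_ite_mem, Finset.univ_inter]
  rw [h]
  refine Finset.sum_congr rfl fun v _ => ?_
  simp only [friendliness_eq, restrictedSign, Finset.mul_sum, mul_assoc]
  split_ifs <;> simp

lemma restrictedSign_mem_signVectors (A D : Finset (Fin n)) :
    restrictedSign A D ∈ signVectors n := by
  refine Fintype.mem_piFinset.mpr fun v => ?_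
  unfold restrictedSign sideSign
  split_ifs <;> simp

lemma sideSign_mem_signVectors (A : Finset (Fin n)) : sideSign A ∈ signVectors n := by
  refine Fintype.mem_piFinset.mpr fun v => ?_
  unfold sideSign
  split_ifs <;> simp

lemma sum_restrictedSign_sq (A D : Finset (Fin n)) :
    ∑ v, restrictedSign A D v ^ 2 = D.card := by
  simp [restrictedSign, pow_two, sideSign_sq]

lemma sum_restrictedSign_mul (A D : Finset (Fin n)) :
    ∑ v, restrictedSign A D v * sideSign A v = D.card := by
  simp [restrictedSign, sideSign_sq]

variable {A P R : Finset (Fin n)} {m : ℕ}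

lemma card_union_of_subset_compl (hP : P ⊆ A) (hR : R ⊆ Aᶜ) (hPm : P.card = m)
    (hRm : R.card = m) : (P ∪ R).card = 2 * m := by
  rw [Finset.card_union_of_disjoint (disjoint_compl_right.mono hP hR), hPm, hRm, two_mul]

lemma sum_restrictedSign_union (hP : P ⊆ A) (hR : R ⊆ Aᶜ) (hPm : P.card = m)
    (hRm : R.card = m) : ∑ v, restrictedSign A (P ∪ R) v = 0 := by
  have h1 : ∑ v ∈ P, sideSign A v = m := by
    unfold sideSign
    rw [Finset.sum_congr rfl fun v hv => if_pos (hP hv)]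
    simp [hPm]
  have h2 : ∑ v ∈ R, sideSign A v = -m := by
    unfold sideSign
    rw [Finset.sum_congr rfl fun v hv => if_neg (Finset.mem_compl.mp (hR hv))]
    simp [hRm]
  simp only [restrictedSign, Finset.sum_ite_mem, Finset.univ_inter]
  rw [Finset.sum_union (disjoint_compl_right.mono hP hR), h1, h2]
  ring

lemma sideSign_swap (hP : P ⊆ A) (hR : R ⊆ Aᶜ) :
    sideSign ((A \ P) ∪ R) = fun v => sideSign A v - 2 * restrictedSign A (P ∪ R) v := by
  funext v
  have h1 : v ∈ P → v ∈ A := fun h => hP h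
  have h2 : v ∈ R → v ∉ A := fun h => Finset.mem_compl.mp (hR h)
  simp only [sideSign, restrictedSign, Finset.mem_union, Finset.mem_sdiff]
  by_cases hA : v ∈ A <;> by_cases hvP : v ∈ P <;> by_cases hvR : v ∈ R <;>
    simp_all <;> norm_num

/-- The change of the total friendliness when equally many vertices of both parts are exchanged. -/
lemma totalFriendliness_swap (G : SimpleGraph (Fin n)) (hP : P ⊆ A) (hR : R ⊆ Aᶜ)
    (hPm : P.card = m) (hRm : R.card = m) :
    (totalFriendliness G ((A \ P) ∪ R) : ℝ) = totalFriendliness G A -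
      4 * ∑ v ∈ P ∪ R, (friendliness G A v : ℝ) - 4 * m +
      2 * signForm G (restrictedSign A (P ∪ R)) (restrictedSign A (P ∪ R)) := by
  rw [totalFriendliness_eq_adjForm, totalFriendliness_eq_adjForm, sideSign_swap hP hR,
    adjForm_sub_two_mul, adjForm_restrictedSign,
    adjForm_eq_signForm G (restrictedSign A (P ∪ R)) (restrictedSign A (P ∪ R)),
    sum_restrictedSign_union hP hR hPm hRm]
  simp only [← pow_two, sum_restrictedSign_sq, card_union_of_subset_compl hP hR hPm hRm]
  push_cast
  ring

lemma sum_friendliness_swap (G : SimpleGraph (Fin n)) (hP : P ⊆ A) (hR : R ⊆ Aᶜ)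
    (hPm : P.card = m) (hRm : R.card = m) :
    ∑ v ∈ P ∪ R, (friendliness G A v : ℝ) =
      (-(2 * m) + signForm G (restrictedSign A (P ∪ R)) (sideSign A)) / 2 := by
  rw [← adjForm_restrictedSign, adjForm_eq_signForm, sum_restrictedSign_union hP hR hPm hRm,
    sum_restrictedSign_mul, card_union_of_subset_compl hP hR hPm hRm]
  push_cast
  ring

lemma friendliness_lt_of_mostUnfriendlyIn {G : SimpleGraph (Fin n)} {A P P' : Finset (Fin n)}
    {s : ℕ} {K : ℝ} (hP' : MostUnfriendlyIn G A P m P')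
    (hcard : m + s ≤ (P.filter fun v => friendliness G A v ≤ 0).card)
    (hK : ∀ S : Finset (Fin n), S.card = s → ∃ v ∈ S, K < |(friendliness G A v : ℝ)|) :
    ∀ v ∈ P', (friendliness G A v : ℝ) < -K := by
  obtain ⟨-, hm, hmin⟩ := hP'
  intro v hv
  by_contra! hlt
  have hs : s ≤ ((P.filter fun v => friendliness G A v ≤ 0) \ P').card := by
    have := Finset.le_card_sdiff P' (P.filter fun v => friendliness G A v ≤ 0)
    omega
  obtain ⟨S, hS, hSs⟩ := Finset.exists_subset_card_eq hs
  obtain ⟨w, hw, hKw⟩ := hK S hSs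
  obtain ⟨hwP, hwP'⟩ := Finset.mem_sdiff.mp (hS hw)
  obtain ⟨hwP, hw0⟩ := Finset.mem_filter.mp hwP
  have hvw : friendliness G A v ≤ friendliness G A w := by
    rcases hmin v hv w (Finset.mem_sdiff.mpr ⟨hwP, hwP'⟩) with h | h
    · exact h.le
    · exact h.1.le
  have hvw' : (friendliness G A v : ℝ) ≤ friendliness G A w := by exact_mod_cast hvw
  have hw0' : (friendliness G A w : ℝ) ≤ 0 := by exact_mod_cast hw0
  rw [abs_of_nonpos hw0'] at hKw
  linarith

lemma totalFriendliness_of_isAlphaSwapOutcome {α a b t₁ t₂ K : ℝ} {s : ℕ}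
    {G : SimpleGraph (Fin n)} {A A₁ : Finset (Fin n)}
    (hanti : ∀ S : Finset (Fin n), S.card = s → ∃ v ∈ S, K < |(friendliness G A v : ℝ)|)
    (hself : ∀ z ∈ signVectors n, ∑ i, z i ^ 2 ≤ a → |signForm G z z| < t₁)
    (hpair : ∀ z ∈ signVectors n, ∑ i, z i ^ 2 ≤ b → ∀ y ∈ signVectors n, |signForm G z y| < t₂)
    (hA : ⌊α * n⌋₊ + s ≤ (A.filter fun v => friendliness G A v ≤ 0).card)
    (hAc : ⌊α * n⌋₊ + s ≤ (Aᶜ.filter fun v => friendliness G A v ≤ 0).card)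
    (ha : 2 * (⌊α * n⌋₊ : ℝ) ≤ a) (hb : 2 * (⌊α ^ 4 * n⌋₊ : ℝ) ≤ b)
    (h : IsAlphaSwapOutcome α G A A₁) :
    (totalFriendliness G A : ℝ) + 8 * ⌊α * n⌋₊ * K - 4 * ⌊α * n⌋₊ - 2 * t₁ - 4 * t₂ ≤
      totalFriendliness G A₁ := by
  obtain ⟨A', B', S, T, hA', hB', hS, hT, hSk, hTk, rfl⟩ := h
  set m := ⌊α * n⌋₊
  set k := ⌊α ^ 4 * n⌋₊
  have hgain : ∑ v ∈ A' ∪ B', (friendliness G A v : ℝ) ≤ (2 * m : ℕ) * -K := by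
    rw [← card_union_of_subset_compl hA'.1 hB'.1 hA'.2.1 hB'.2.1, ← nsmul_eq_mul]
    refine Finset.sum_le_card_nsmul _ _ _ fun v hv => ?_
    rcases Finset.mem_union.mp hv with hv | hv
    · exact (friendliness_lt_of_mostUnfriendlyIn hA' hA hanti v hv).le
    · exact (friendliness_lt_of_mostUnfriendlyIn hB' hAc hanti v hv).le
  have hz := abs_lt.mp (hself _ (restrictedSign_mem_signVectors A (A' ∪ B')) (by
    rw [sum_restrictedSign_sq, card_union_of_subset_compl hA'.1 hB'.1 hA'.2.1 hB'.2.1]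
    push_cast
    exact ha))
  have hw := hpair _ (restrictedSign_mem_signVectors ((A \ A') ∪ B') (S ∪ T)) (by
    rw [sum_restrictedSign_sq, card_union_of_subset_compl hS hT hSk hTk]
    push_cast
    exact hb)
  have hw₁ := abs_lt.mp (hw _ (sideSign_mem_signVectors ((A \ A') ∪ B')))
  have hw₂ := abs_lt.mp (hw _ (restrictedSign_mem_signVectors ((A \ A') ∪ B') (S ∪ T)))
  rw [totalFriendliness_swap G hS hT hSk hTk, sum_friendliness_swap G hS hT hSk hTk,
    totalFriendliness_swap G hA'.1 hB'.1 hA'.2.1 hB'.2.1]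
  push_cast at hgain
  linarith [hz.1, hw₁.2, hw₂.1]

end Swap

section Asymptotics

lemma pow_le_exp_of_anticoncentration {e δ : ℝ} {n s : ℕ} (he : 0 < e) (he1 : e ≤ 1)
    (hδ : δ = Real.exp (-(6 / e)) / 6) (hs : e * n / 2 ≤ s) (hs' : (s : ℝ) ≤ e * n / 2 + 1)
    (hsn : s ≤ n) (hn : 1 ≤ δ * √n) :
    (4 : ℝ) ^ n * ((2 * (δ * √n) + 1) / √((n - s : ℕ) + 1)) ^ s ≤ Real.exp (-(1 * n)) := by
  have hroot : √(n : ℝ) / 2 ≤ √((n - s : ℕ) + 1) := by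
    apply Real.le_sqrt_of_sq_le
    rw [div_pow, Real.sq_sqrt (by positivity), Nat.cast_sub hsn]
    nlinarith [mul_le_mul_of_nonneg_right he1 (Nat.cast_nonneg (α := ℝ) n)]
  have hδ0 : 0 < δ := by rw [hδ]; positivity
  have hroot0 : 0 < √(n : ℝ) := pos_of_mul_pos_right (by linarith) hδ0.le
  have hbase : (2 * (δ * √n) + 1) / √((n - s : ℕ) + 1) ≤ Real.exp (-(6 / e)) := by
    rw [div_le_iff₀ (by positivity)]
    calc 2 * (δ * √n) + 1 ≤ 6 * δ * (√n / 2) := by linarith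
      _ = Real.exp (-(6 / e)) * (√n / 2) := by rw [hδ]; ring
      _ ≤ _ := by gcongr
  have h4 : (4 : ℝ) ≤ Real.exp 2 := by
    have h1 := Real.add_one_le_exp 1
    have h2 : Real.exp 2 = Real.exp 1 ^ 2 := by rw [← Real.exp_nat_mul]; norm_num
    rw [h2]
    nlinarith
  calc (4 : ℝ) ^ n * ((2 * (δ * √n) + 1) / √((n - s : ℕ) + 1)) ^ s
      ≤ Real.exp 2 ^ n * Real.exp (-(6 / e)) ^ s := by gcongr
    _ = Real.exp (n * 2 + s * -(6 / e)) := by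
        rw [← Real.exp_nat_mul, ← Real.exp_nat_mul, ← Real.exp_add]
    _ ≤ Real.exp (-(1 * n)) := by
        refine Real.exp_le_exp.mpr ?_
        have : e * n / 2 * (6 / e) ≤ s * (6 / e) := by gcongr
        have h3 : e * n / 2 * (6 / e) = 3 * n := by field_simp; ring
        linarith

lemma tendsto_exp_neg_mul_nat {c : ℝ} (hc : 0 < c) :
    Tendsto (fun n : ℕ => Real.exp (-(c * n))) atTop (nhds 0) :=
  Real.tendsto_exp_neg_atTop_nhds_zero.comp
    (tendsto_natCast_atTop_atTop.const_mul_atTop hc)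

end Asymptotics

section WithHighProbability

variable {n : ℕ} {e δ L α : ℝ}

lemma graphProb_not_forall_anticoncentrated_le (he : 0 < e) (he1 : e ≤ 1)
    (hδ : δ = Real.exp (-(6 / e)) / 6) (hn : 6 ≤ δ * √n) (hen : 4 ≤ e * n) :
    graphProb n (fun G => ¬ ∀ A S : Finset (Fin n), S.card = ⌈e * n / 2⌉₊ →
      ∃ v ∈ S, δ * √n < |(friendliness G A v : ℝ)|) ≤ Real.exp (-(1 * n)) := by
  have hs := Nat.le_ceil (e * n / 2)
  have hs' := (Nat.ceil_lt_add_one (a := e * n / 2) (by positivity)).le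
  have hle : e * n ≤ n := mul_le_of_le_one_left (by positivity) he1
  have hsn : ⌈e * n / 2⌉₊ ≤ n := Nat.ceil_le.mpr (by linarith)
  refine (graphProb_mono fun G hG => ?_).trans
    ((graphProb_exists_abs_friendliness_le ⌈e * n / 2⌉₊ (K := δ * √n) (by linarith)).trans
      (pow_le_exp_of_anticoncentration he he1 hδ hs hs' hsn (by linarith)))
  push Not at hG
  obtain ⟨A, S, hS, hG⟩ := hG
  exact ⟨(A, S), by simp [hS], hG⟩

lemma graphProb_not_forall_signForm_self_le (hn : 0 < n) (hδ : 0 < δ) (hα : 0 < α) (hL : 0 ≤ L)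
    (hLδ : 2 * Real.exp (-L) = δ ^ 2 / 64) (hαL : 2 * α * L ≤ δ ^ 2 / 64) :
    graphProb n (fun G => ¬ ∀ z ∈ signVectors n, ∑ i, z i ^ 2 ≤ 2 * α * n →
      |signForm G z z| < δ * α * (n * √n)) ≤ 2 * Real.exp (-(δ ^ 2 / 32 * n)) := by
  have hn0 : (0 : ℝ) < n := by exact_mod_cast hn
  refine (graphProb_mono fun G hG => ?_).trans
    ((graphProb_exists_signForm_self_le (a := 2 * α * n) (t := δ * α * (n * √n)) (L := L)
      (by positivity) (by positivity) hL).trans ?_)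
  · push Not at hG
    obtain ⟨z, hz, hza, hG⟩ := hG
    exact ⟨z, Finset.mem_filter.mpr ⟨hz, hza⟩, hG⟩
  · rw [mul_left_comm, ← Real.exp_add]
    gcongr
    have h : -(δ * α * (n * √n)) ^ 2 / (4 * (2 * α * n * (2 * α * n))) = -(δ ^ 2 / 16 * n) := by
      rw [mul_pow, mul_pow (n : ℝ), Real.sq_sqrt hn0.le]
      field_simp
      ring
    rw [h, hLδ]
    nlinarith [mul_le_mul_of_nonneg_right hαL hn0.le]

lemma graphProb_not_forall_signForm_le (hn : 0 < n) (hα : 0 < α) :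
    graphProb n (fun G => ¬ ∀ z ∈ signVectors n, ∑ i, z i ^ 2 ≤ 2 * α ^ 4 * n →
      ∀ y ∈ signVectors n, |signForm G z y| < 7 * α ^ 2 * (n * √n)) ≤
      2 * Real.exp (-(1 * n)) := by
  have hn0 : (0 : ℝ) < n := by exact_mod_cast hn
  refine (graphProb_mono fun G hG => ?_).trans
    ((graphProb_exists_signForm_le hn (a := 2 * α ^ 4 * n) (t := 7 * α ^ 2 * (n * √n))
      (by positivity) (by positivity)).trans ?_)
  · push Not at hG
    obtain ⟨z, hz, hza, y, hy, hG⟩ := hG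
    exact ⟨(z, y), Finset.mem_product.mpr ⟨Finset.mem_filter.mpr ⟨hz, hza⟩, hy⟩, hG⟩
  · rw [mul_left_comm, ← Real.exp_add]
    gcongr
    have h : -(7 * α ^ 2 * (n * √n)) ^ 2 / (4 * (2 * α ^ 4 * n * n)) = -(49 / 8 * n) := by
      rw [mul_pow, mul_pow (n : ℝ), Real.sq_sqrt hn0.le]
      field_simp
      ring
    rw [h]
    linarith

lemma totalFriendliness_add_le_of_isAlphaSwapOutcome {G : SimpleGraph (Fin n)}
    (hα : 0 < α) (hαe : α ≤ e / 4) (hαδ : α ≤ δ / 28)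
    (hn : 6 ≤ δ * √n) (hαn : 4 ≤ α * n)
    (hanti : ∀ A S : Finset (Fin n), S.card = ⌈e * n / 2⌉₊ →
      ∃ v ∈ S, δ * √n < |(friendliness G A v : ℝ)|)
    (hself : ∀ z ∈ signVectors n, ∑ i, z i ^ 2 ≤ 2 * α * n →
      |signForm G z z| < δ * α * (n * √n))
    (hpair : ∀ z ∈ signVectors n, ∑ i, z i ^ 2 ≤ 2 * α ^ 4 * n → ∀ y ∈ signVectors n,
      |signForm G z y| < 7 * α ^ 2 * (n * √n))
    (A A₁ : Finset (Fin n))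
    (hA : e * n ≤ ((A.filter fun v => friendliness G A v ≤ 0).card : ℝ))
    (hAc : e * n ≤ ((Aᶜ.filter fun v => friendliness G A v ≤ 0).card : ℝ))
    (h : IsAlphaSwapOutcome α G A A₁) :
    (totalFriendliness G A : ℝ) + δ * α * (n : ℝ) ^ (3 / 2 : ℝ) ≤ totalFriendliness G A₁ := by
  have hn0 : (0 : ℝ) < n := pos_of_mul_pos_right (by linarith) hα.le
  have hαen : α * n ≤ e * n / 4 := by nlinarith
  have hm := Nat.floor_le (a := α * n) (by positivity)
  have hm' := (Nat.lt_floor_add_one (α * n)).le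
  have hk := Nat.floor_le (a := α ^ 4 * n) (by positivity)
  have hs := (Nat.ceil_lt_add_one (a := e * n / 2) (by linarith)).le
  have hms : ((⌊α * n⌋₊ + ⌈e * n / 2⌉₊ : ℕ) : ℝ) ≤ e * n := by
    push_cast
    linarith
  have hmain := totalFriendliness_of_isAlphaSwapOutcome (hanti A) hself hpair
    (by exact_mod_cast hms.trans hA) (by exact_mod_cast hms.trans hAc)
    (by linarith) (by linarith) h
  have hpow : (n : ℝ) ^ (3 / 2 : ℝ) = n * √n := by
    rw [show (3 / 2 : ℝ) = 1 + 1 / 2 by norm_num, Real.rpow_add hn0, Real.rpow_one,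
      Real.sqrt_eq_rpow]
  rw [hpow]
  have h1 : (α * n - 1) * (δ * √n) ≤ ⌊α * n⌋₊ * (δ * √n) :=
    mul_le_mul_of_nonneg_right (by linarith) (by linarith)
  have h2 : 28 * α ^ 2 * (n * √n) ≤ δ * α * (n * √n) := by
    have : 28 * α ^ 2 ≤ δ * α := by nlinarith
    exact mul_le_mul_of_nonneg_right this (by positivity)
  have h3 : 6 * (α * n) ≤ δ * √n * (α * n) := mul_le_mul_of_nonneg_right hn (by positivity)
  have h4 : 4 * (δ * √n) ≤ α * n * (δ * √n) := mul_le_mul_of_nonneg_right hαn (by linarith)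
  linarith

lemma one_sub_le_graphProb_alphaSwap (he : 0 < e) (he1 : e ≤ 1)
    (hδ : δ = Real.exp (-(6 / e)) / 6) (hα : 0 < α) (hαe : α ≤ e / 4) (hαδ : α ≤ δ / 28)
    (hL : 0 ≤ L) (hLδ : 2 * Real.exp (-L) = δ ^ 2 / 64) (hαL : 2 * α * L ≤ δ ^ 2 / 64)
    (hn : 6 ≤ δ * √n) (hαn : 4 ≤ α * n) :
    1 - (Real.exp (-(1 * n)) + 2 * Real.exp (-(δ ^ 2 / 32 * n)) + 2 * Real.exp (-(1 * n))) ≤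
      graphProb n (fun G => ∀ A : Finset (Fin n),
        e * n ≤ ((A.filter fun v => friendliness G A v ≤ 0).card : ℝ) →
        e * n ≤ ((Aᶜ.filter fun v => friendliness G A v ≤ 0).card : ℝ) →
        ∀ A₁ : Finset (Fin n), IsAlphaSwapOutcome α G A A₁ →
          (totalFriendliness G A : ℝ) + δ * α * (n : ℝ) ^ (3 / 2 : ℝ) ≤
            (totalFriendliness G A₁ : ℝ)) := by
  have hδ0 : 0 < δ := by rw [hδ]; positivity
  have hn0 : (0 : ℝ) < n := pos_of_mul_pos_right (by linarith) hα.le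
  have hn0' : 0 < n := by exact_mod_cast hn0
  have hen : 4 ≤ e * n := by nlinarith
  rw [sub_le_comm, ← graphProb_not]
  refine (graphProb_mono fun G hG => ?_).trans ((graphProb_or_le _ _).trans
    (add_le_add ((graphProb_or_le _ _).trans (add_le_add
      (graphProb_not_forall_anticoncentrated_le he he1 hδ hn hen)
      (graphProb_not_forall_signForm_self_le hn0' hδ0 hα hL hLδ hαL)))
      (graphProb_not_forall_signForm_le hn0' hα)))
  rw [← not_and_or, ← not_and_or]
  rintro ⟨⟨hanti, hself⟩, hpair⟩
  exact hG fun A hA hAc A₁ hA₁ => totalFriendliness_add_le_of_isAlphaSwapOutcome hα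
    hαe hαδ hn hαn hanti hself hpair A A₁ hA hAc hA₁

end WithHighProbability

/-- for every `ε > 0` there are `α ∈ (0,ε)` and `β > 0` such that, with high
probability, for every bisection `A ∪ Aᶜ` of `G(n,1/2)` with at least `εn` unfriendly vertices
in each part, every outcome of an `α`-swap increases the total friendliness by at least
`β n^{3/2}`. -/
theorem statement2 (ε : ℝ) (hε : 0 < ε) :
    ∃ α : ℝ, 0 < α ∧ α < ε ∧ ∃ β : ℝ, 0 < β ∧
      Tendsto (fun n : ℕ => graphProb n (fun G => ∀ A : Finset (Fin n), IsBisection A →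
          ε * n ≤ ((A.filter fun v => friendliness G A v ≤ 0).card : ℝ) →
          ε * n ≤ ((Aᶜ.filter fun v => friendliness G A v ≤ 0).card : ℝ) →
          ∀ A₁ : Finset (Fin n), IsAlphaSwapOutcome α G A A₁ →
            (totalFriendliness G A : ℝ) + β * (n : ℝ) ^ (3 / 2 : ℝ) ≤
              (totalFriendliness G A₁ : ℝ)))
        atTop (nhds 1) := by
  set e := min ε 1
  have he : 0 < e := lt_min hε one_pos
  have he1 : e ≤ 1 := min_le_right _ _
  have heε : e ≤ ε := min_le_left _ _
  obtain ⟨δ, hδ⟩ : ∃ δ, δ = Real.exp (-(6 / e)) / 6 := ⟨_, rfl⟩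
  have hδ0 : 0 < δ := by rw [hδ]; positivity
  have hδ1 : δ ≤ 1 / 6 := by
    have : Real.exp (-(6 / e)) ≤ 1 := Real.exp_le_one_iff.mpr (by simp; positivity)
    linarith
  set L := Real.log (128 / δ ^ 2)
  have hL : 0 < L := by
    refine Real.log_pos ?_
    rw [lt_div_iff₀ (by positivity)]
    nlinarith
  have hLδ : 2 * Real.exp (-L) = δ ^ 2 / 64 := by
    rw [Real.exp_neg, Real.exp_log (by positivity)]
    field_simp
    norm_num
  set α := min (e / 4) (min (δ / 28) (δ ^ 2 / (128 * L)))
  have hα : 0 < α := by positivity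
  have hαe : α ≤ e / 4 := min_le_left _ _
  have hαδ : α ≤ δ / 28 := (min_le_right _ _).trans (min_le_left _ _)
  have hαL : 2 * α * L ≤ δ ^ 2 / 64 := by
    have : α ≤ δ ^ 2 / (128 * L) := (min_le_right _ _).trans (min_le_right _ _)
    rw [le_div_iff₀ (by positivity)] at this
    linarith
  refine ⟨α, hα, by linarith, δ * α, by positivity, ?_⟩
  have hlim : Tendsto (fun n : ℕ => 1 - (Real.exp (-(1 * n)) +
      2 * Real.exp (-(δ ^ 2 / 32 * n)) + 2 * Real.exp (-(1 * n)))) atTop (nhds 1) := by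
    have h1 := tendsto_exp_neg_mul_nat one_pos
    have h2 := tendsto_exp_neg_mul_nat (c := δ ^ 2 / 32) (by positivity)
    simpa using ((h1.add (h2.const_mul 2)).add (h1.const_mul 2)).const_sub 1
  have hlarge : ∀ᶠ n : ℕ in atTop, 6 ≤ δ * √(n : ℝ) :=
    ((Real.tendsto_sqrt_atTop.comp tendsto_natCast_atTop_atTop).const_mul_atTop
      hδ0).eventually_ge_atTop 6
  have hlarge' : ∀ᶠ n : ℕ in atTop, 4 ≤ α * (n : ℝ) :=
    (tendsto_natCast_atTop_atTop.const_mul_atTop hα).eventually_ge_atTop 4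
  refine tendsto_of_tendsto_of_tendsto_of_le_of_le' hlim tendsto_const_nhds ?_
    (Eventually.of_forall fun n => graphProb_le_one _)
  filter_upwards [hlarge, hlarge'] with n hn hαn
  refine (one_sub_le_graphProb_alphaSwap he he1 hδ hα hαe hαδ hL.le hLδ hαL hn hαn).trans
    (graphProb_mono fun G hG A _ hA hAc => hG A ?_ ?_)
  · exact (mul_le_mul_of_nonneg_right heε (Nat.cast_nonneg n)).trans hA
  · exact (mul_le_mul_of_nonneg_right heε (Nat.cast_nonneg n)).trans hAc
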